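/- Assume (H_c). Fix σ ≥ 0, let α_σ := inf{α ∈ [0,1) : there exists a right solution with speed σ on (α,1]}, and let V_σ be the (unique) right solution with speed σ defined on (α_σ,1]. If α_σ > 0, then lim_{u→α_σ⁺} V_σ(u) = a₊(α_σ), and in particular this limit is finite and positive. -/

import Mathlib

open Set Filter Topology
open scoped ENNReal

noncomputable section

/-- The strip `Ω` between `-ω` and `ω` over `[0,1]`:
`Ω = {(u,s) : u ∈ [0,1], -ω(u) < s < ω(u)}`. -/
def OmegaSet (ω : ℝ → ℝ≥0∞) : Set (ℝ × ℝ) :=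
  {p | p.1 ∈ Set.Icc (0:ℝ) 1 ∧ ENNReal.ofReal |p.2| < ω p.1}

/-- The set `𝒟` between `a₋ = -a₊` and `a₊` over `[0,1]`. -/
def DSet (aplus : ℝ → ℝ≥0∞) : Set (ℝ × ℝ) :=
  {p | p.1 ∈ Set.Icc (0:ℝ) 1 ∧ ENNReal.ofReal |p.2| < aplus p.1}

/-- Standing data and hypotheses: a lower semicontinuous width `ω : [0,1] → (0,∞]`,
a regular flux `a` on `Ω` (odd in `s`, C¹, with `∂a/∂s > 0`), the maximal fluxes
`a₊(u) = lim_{s→ω(u)⁻} a(u,s)` (equivalently, the supremum over `0 < s < ω(u)`),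
which are `+∞` whenever `ω(u) < ∞`, the partial inverse `g` on `𝒟` defined by
`a(u, g(u,v)) = v`, and a logistic-type reaction term `f`. -/
structure FluxData where
  ω : ℝ → ℝ≥0∞
  a : ℝ → ℝ → ℝ
  aplus : ℝ → ℝ≥0∞
  g : ℝ → ℝ → ℝ
  f : ℝ → ℝ
  ω_pos : ∀ u ∈ Set.Icc (0:ℝ) 1, 0 < ω u
  ω_lsc : LowerSemicontinuousOn ω (Set.Icc (0:ℝ) 1)
  a_odd : ∀ u s, (u, s) ∈ OmegaSet ω → a u (-s) = - a u s
  a_C1 : ContDiffOn ℝ 1 (fun p : ℝ × ℝ => a p.1 p.2) (OmegaSet ω)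
  a_deriv_pos : ∀ u s, (u, s) ∈ OmegaSet ω → ∃ d : ℝ, 0 < d ∧ HasDerivAt (a u) d s
  aplus_def : ∀ u ∈ Set.Icc (0:ℝ) 1,
      aplus u = ⨆ s ∈ {s : ℝ | 0 < s ∧ (u, s) ∈ OmegaSet ω}, ENNReal.ofReal (a u s)
  aplus_pos : ∀ u ∈ Set.Icc (0:ℝ) 1, 0 < aplus u
  aplus_top : ∀ u ∈ Set.Icc (0:ℝ) 1, ω u < ⊤ → aplus u = ⊤
  g_spec : ∀ p ∈ DSet aplus, (p.1, g p.1 p.2) ∈ OmegaSet ω ∧ a p.1 (g p.1 p.2) = p.2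
  f_C1 : ContDiffOn ℝ 1 f (Set.Icc (0:ℝ) 1)
  f_zero : f 0 = 0
  f_one : f 1 = 0
  f_pos : ∀ u ∈ Set.Ioo (0:ℝ) 1, 0 < f u

/-- A classic traveling wave of `u_t = (b(u,u_x))_x + f(u)` moving at speed `σ`:
a C² increasing profile `u` with values in `(0,1)`, `0 < u' < ω(u)`, connecting
`0` at `-∞` to `1` at `+∞`, such that `ξ ↦ b(u(ξ),u'(ξ))` is differentiable and
`(b(u,u'))' - σ u' + f(u) = 0`. -/
def IsClassicTW (F : FluxData) (b : ℝ → ℝ → ℝ) (σ : ℝ) (u : ℝ → ℝ) : Prop :=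
  ContDiff ℝ 2 u ∧
  (∀ ξ : ℝ, u ξ ∈ Set.Ioo (0:ℝ) 1) ∧
  (∀ ξ : ℝ, 0 < deriv u ξ ∧ ENNReal.ofReal (deriv u ξ) < F.ω (u ξ)) ∧
  Filter.Tendsto u Filter.atBot (nhds 0) ∧
  Filter.Tendsto u Filter.atTop (nhds 1) ∧
  (∀ ξ : ℝ, HasDerivAt (fun t => b (u t) (deriv u t)) (σ * deriv u ξ - F.f (u ξ)) ξ)

/-- A right solution with speed `σ`: `V : (α,1] → ℝ`, continuous on `(α,1]`,
C¹ on `(α,1)`, `V(1) = 0`, and on `(α,1)` : `V > 0`, `(u,V(u)) ∈ 𝒟` and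
`V' = σ - f(u)/g(u,V(u))`. -/
def IsRightSolution (F : FluxData) (σ α : ℝ) (V : ℝ → ℝ) : Prop :=
  α ∈ Set.Ico (0:ℝ) 1 ∧
  ContinuousOn V (Set.Ioc α 1) ∧
  V 1 = 0 ∧
  ∀ u ∈ Set.Ioo α 1, 0 < V u ∧ (u, V u) ∈ DSet F.aplus ∧
    HasDerivAt V (σ - F.f u / F.g u (V u)) u

open Classical in
/-- `ℋ(u,V) = 1/g(u,V)` if `0 < V < a₊(u)`, and `0` if `V ≥ a₊(u)`. -/
def Hfun (F : FluxData) (u V : ℝ) : ℝ :=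
  if ENNReal.ofReal V < F.aplus u then 1 / F.g u V else 0

/-- The solution `𝒱_σ` of the extended problem: continuous on `[0,1]`, C¹ on `(0,1)`,
`𝒱(1) = 0`, `𝒱 > 0` on `(0,1)` and `𝒱' = σ - f(u)·ℋ(u,𝒱(u))` on `(0,1)`. -/
def IsVsol (F : FluxData) (σ : ℝ) (V : ℝ → ℝ) : Prop :=
  ContinuousOn V (Set.Icc (0:ℝ) 1) ∧ V 1 = 0 ∧
  (∀ u ∈ Set.Ioo (0:ℝ) 1, 0 < V u) ∧
  (∀ u ∈ Set.Ioo (0:ℝ) 1, HasDerivAt V (σ - F.f u * Hfun F u (V u)) u)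

namespace FluxData

variable (F : FluxData)

theorem mem_nhds_OmegaSet {u s : ℝ} (hu : u ∈ Ioo (0:ℝ) 1) (h : (u, s) ∈ OmegaSet F.ω) :
    OmegaSet F.ω ∈ 𝓝 (u, s) := by
  obtain ⟨c, hc1, hc2⟩ := exists_between h.2
  have h1 : ∀ᶠ p : ℝ × ℝ in 𝓝 (u, s), p.1 ∈ Icc (0:ℝ) 1 :=
    continuous_fst.continuousAt.eventually (Icc_mem_nhds hu.1 hu.2)
  have h2 : ∀ᶠ p : ℝ × ℝ in 𝓝 (u, s), c < F.ω p.1 := by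
    have h3 : ∀ᶠ x in 𝓝[Icc 0 1] u, c < F.ω x := F.ω_lsc u (Ioo_subset_Icc_self hu) c hc2
    rw [nhdsWithin_eq_nhds.2 (Icc_mem_nhds hu.1 hu.2)] at h3
    exact (continuous_fst.tendsto (u, s)).eventually h3
  have h4 : ∀ᶠ p : ℝ × ℝ in 𝓝 (u, s), ENNReal.ofReal |p.2| < c :=
    (ENNReal.continuous_ofReal.comp (continuous_abs.comp continuous_snd)).continuousAt.eventually
      (gt_mem_nhds hc1)
  filter_upwards [h1, h2, h4] with p h1 h2 h4 using ⟨h1, h4.trans h2⟩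

theorem mem_nhds_DSet (hc : ContinuousOn F.aplus (Icc (0:ℝ) 1)) {u v : ℝ} (hu : u ∈ Ioo (0:ℝ) 1)
    (h : (u, v) ∈ DSet F.aplus) : DSet F.aplus ∈ 𝓝 (u, v) := by
  have hI := Icc_mem_nhds hu.1 hu.2
  have h1 : ContinuousAt (fun p : ℝ × ℝ => F.aplus p.1) (u, v) :=
    ContinuousAt.comp (f := Prod.fst) (hc.continuousAt hI) continuous_fst.continuousAt
  have h2 : ContinuousAt (fun p : ℝ × ℝ => ENNReal.ofReal |p.2|) (u, v) :=
    (ENNReal.continuous_ofReal.comp (continuous_abs.comp continuous_snd)).continuousAt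
  filter_upwards [continuous_fst.continuousAt.eventually hI, h2.eventually_lt h1 h.2] with p h3 h4
    using ⟨h3, h4⟩

theorem a_strictMonoOn (u : ℝ) : StrictMonoOn (F.a u) {s | (u, s) ∈ OmegaSet F.ω} := by
  intro s hs t ht hst
  have hsub : ∀ x ∈ Icc s t, (u, x) ∈ OmegaSet F.ω := fun x hx =>
    ⟨hs.1, (ENNReal.ofReal_le_ofReal (abs_le_max_abs_abs hx.1 hx.2)).trans_lt (by
      rcases max_choice |s| |t| with h | h <;> rw [h]
      exacts [hs.2, ht.2])⟩
  refine strictMonoOn_of_deriv_pos (convex_Icc s t) (fun x hx => ?_) (fun x hx => ?_)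
    (left_mem_Icc.2 hst.le) (right_mem_Icc.2 hst.le) hst
  · obtain ⟨d, _, hd⟩ := F.a_deriv_pos u x (hsub x hx)
    exact hd.continuousAt.continuousWithinAt
  · obtain ⟨d, hd0, hd⟩ := F.a_deriv_pos u x (hsub x (interior_subset hx))
    rwa [hd.deriv]

theorem g_mono {u v w : ℝ} (hv : (u, v) ∈ DSet F.aplus) (hw : (u, w) ∈ DSet F.aplus)
    (h : v ≤ w) : F.g u v ≤ F.g u w := by
  obtain ⟨h1, h2⟩ := F.g_spec _ hv
  obtain ⟨h3, h4⟩ := F.g_spec _ hw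
  rw [← (F.a_strictMonoOn u).le_iff_le h1 h3]
  exact h2.le.trans (h.trans h4.ge)

theorem zero_mem_DSet {u : ℝ} (hu : u ∈ Icc (0:ℝ) 1) : (u, (0:ℝ)) ∈ DSet F.aplus :=
  ⟨hu, by simpa using F.aplus_pos u hu⟩

theorem zero_mem_OmegaSet {u : ℝ} (hu : u ∈ Icc (0:ℝ) 1) : (u, (0:ℝ)) ∈ OmegaSet F.ω :=
  ⟨hu, by simpa using F.ω_pos u hu⟩

theorem a_zero {u : ℝ} (hu : u ∈ Icc (0:ℝ) 1) : F.a u 0 = 0 := by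
  have := F.a_odd u 0 (F.zero_mem_OmegaSet hu)
  rw [neg_zero] at this
  linarith

theorem g_zero {u : ℝ} (hu : u ∈ Icc (0:ℝ) 1) : F.g u 0 = 0 := by
  obtain ⟨h1, h2⟩ := F.g_spec _ (F.zero_mem_DSet hu)
  exact (F.a_strictMonoOn u).injOn h1 (F.zero_mem_OmegaSet hu) (h2.trans (F.a_zero hu).symm)

theorem g_pos {u v : ℝ} (h : (u, v) ∈ DSet F.aplus) (hv : 0 < v) : 0 < F.g u v := by
  obtain ⟨h1, h2⟩ := F.g_spec _ h
  refine ((F.a_strictMonoOn u).lt_iff_lt (F.zero_mem_OmegaSet h.1) h1).1 ?_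
  rw [F.a_zero h.1]
  exact hv.trans_eq h2.symm

theorem g_contDiffAt (hc : ContinuousOn F.aplus (Icc (0:ℝ) 1)) {u v : ℝ} (hu : u ∈ Ioo (0:ℝ) 1)
    (h : (u, v) ∈ DSet F.aplus) : ContDiffAt ℝ 1 (fun p : ℝ × ℝ => F.g p.1 p.2) (u, v) := by
  obtain ⟨hs, hav⟩ := F.g_spec _ h
  simp only at hs hav
  set s := F.g u v
  have hA : ContDiffAt ℝ 1 (fun p : ℝ × ℝ => F.a p.1 p.2) (u, s) :=
    F.a_C1.contDiffAt (F.mem_nhds_OmegaSet hu hs)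
  have hA' := (hA.differentiableAt one_ne_zero).hasFDerivAt
  set A := fderiv ℝ (fun p : ℝ × ℝ => F.a p.1 p.2) (u, s)
  obtain ⟨d, hd0, hd⟩ := F.a_deriv_pos u s hs
  have hAd : A (0, 1) = d := by
    have h1 : HasDerivAt (fun t : ℝ => ((u, t) : ℝ × ℝ)) (0, 1) s :=
      (hasDerivAt_const s u).prodMk (hasDerivAt_id s)
    exact (HasFDerivAt.comp_hasDerivAt (f := fun t : ℝ => ((u, t) : ℝ × ℝ)) s hA' h1).unique hd
  have hΦ : ContDiffAt ℝ 1 (fun p : ℝ × ℝ => (p.1, F.a p.1 p.2)) (u, s) :=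
    contDiffAt_fst.prodMk hA
  let e : (ℝ × ℝ) ≃L[ℝ] (ℝ × ℝ) := (ContinuousLinearEquiv.refl ℝ ℝ).skewProd
    (ContinuousLinearEquiv.unitsEquivAut ℝ (Units.mk0 d hd0.ne'))
    (A.comp (ContinuousLinearMap.inl ℝ ℝ ℝ))
  have he : (e : (ℝ × ℝ) →L[ℝ] (ℝ × ℝ)) = (ContinuousLinearMap.fst ℝ ℝ ℝ).prod A := by
    ext <;> simp [e, hAd, ← Prod.zero_eq_mk]
  have hΦ' : HasFDerivAt (fun p : ℝ × ℝ => (p.1, F.a p.1 p.2))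
      (e : (ℝ × ℝ) →L[ℝ] (ℝ × ℝ)) (u, s) := by
    rw [he]
    exact hasFDerivAt_fst.prodMk hA'
  have hst := hΦ.hasStrictFDerivAt' hΦ' one_ne_zero
  have hψ := hΦ.to_localInverse hΦ' one_ne_zero
  have hinv := hst.eventually_right_inverse
  have hcont := hst.localInverse_tendsto
  change ContDiffAt ℝ 1 (hst.localInverse _ e (u, s)) _ at hψ
  simp only [hav] at hψ hinv hcont
  refine hψ.snd.congr_of_eventuallyEq ?_
  filter_upwards [hinv, hcont.eventually (F.mem_nhds_OmegaSet hu hs), F.mem_nhds_DSet hc hu h]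
    with q h1 h2 h3
  obtain ⟨h4, h5⟩ := F.g_spec _ h3
  generalize hst.localInverse _ e (u, s) q = z at h1 h2
  obtain ⟨x, y⟩ := z
  obtain ⟨q1, q2⟩ := q
  obtain ⟨rfl, rfl⟩ := Prod.mk.inj h1
  exact (F.a_strictMonoOn x).injOn h4 h2 h5

theorem f_contDiffAt {u : ℝ} (hu : u ∈ Ioo (0:ℝ) 1) : ContDiffAt ℝ 1 F.f u :=
  F.f_C1.contDiffAt (Icc_mem_nhds hu.1 hu.2)

/-- Local solvability of `V' = σ - f(u)/g(u,V)` through an interior point of `𝒟` with `v > 0`. -/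
theorem exists_local_solution (hc : ContinuousOn F.aplus (Icc (0:ℝ) 1)) (σ : ℝ) {α v : ℝ}
    (hα : α ∈ Ioo (0:ℝ) 1) (h : (α, v) ∈ DSet F.aplus) (hv : 0 < v) :
    ∃ c : ℝ → ℝ, c α = v ∧ ∀ᶠ t in 𝓝 α, HasDerivAt c (σ - F.f t / F.g t (c t)) t := by
  have hX : ContDiffAt ℝ 1 (fun p : ℝ × ℝ => ((1:ℝ), σ - F.f p.1 / F.g p.1 p.2)) (α, v) :=
    contDiffAt_const.prodMk (contDiffAt_const.sub
      ((ContDiffAt.comp (f := Prod.fst) (α, v) (F.f_contDiffAt hα) contDiffAt_fst).div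
        (F.g_contDiffAt hc hα h) (F.g_pos h hv).ne'))
  obtain ⟨c, hc0, ε, hε, hc1⟩ :=
    hX.exists_forall_mem_closedBall_exists_eq_forall_mem_Ioo_hasDerivAt₀ α
  have hfst : ∀ t ∈ Ioo (α - ε) (α + ε), (c t).1 = t := by
    have hd : ∀ t ∈ Ioo (α - ε) (α + ε), HasDerivAt (fun t => (c t).1 - t) 0 t := fun t ht => by
      have h1 : HasDerivAt (fun t => (c t).1) 1 t :=
        (hasFDerivAt_fst (p := c t)).comp_hasDerivAt t (hc1 t ht)
      simpa only [sub_self] using h1.fun_sub (hasDerivAt_id' t)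
    intro t ht
    have := isOpen_Ioo.is_const_of_deriv_eq_zero isPreconnected_Ioo
      (fun x hx => (hd x hx).differentiableAt.differentiableWithinAt)
      (fun x hx => (hd x hx).deriv) ht (show α ∈ Ioo (α - ε) (α + ε) by constructor <;> linarith)
    simp only [hc0, sub_self] at this
    linarith
  refine ⟨fun t => (c t).2, by simp [hc0], ?_⟩
  filter_upwards [Ioo_mem_nhds (show α - ε < α by linarith) (show α < α + ε by linarith)] with t ht
  have : HasDerivAt (fun t => (c t).2) (σ - F.f (c t).1 / F.g (c t).1 (c t).2) t :=
    (hasFDerivAt_snd (p := c t)).comp_hasDerivAt t (hc1 t ht)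
  simpa only [hfst t ht] using this

end FluxData

namespace IsRightSolution

variable {F : FluxData} {σ α : ℝ} {V : ℝ → ℝ}

theorem mem_Ioo (hV : IsRightSolution F σ α V) (hα : 0 < α) : α ∈ Ioo (0:ℝ) 1 := ⟨hα, hV.1.2⟩

theorem antitoneOn (hV : IsRightSolution F σ α V) :
    AntitoneOn (fun u => V u - σ * u) (Ioo α 1) := by
  have hd : ∀ u ∈ Ioo α 1, HasDerivAt (fun u => V u - σ * u)
      (σ - F.f u / F.g u (V u) - σ * 1) u := fun u hu =>
    (hV.2.2.2 u hu).2.2.sub ((hasDerivAt_id u).const_mul σ)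
  refine antitoneOn_of_deriv_nonpos (convex_Ioo α 1)
    (fun u hu => (hd u hu).continuousAt.continuousWithinAt) ?_ ?_ <;> rw [interior_Ioo]
  · exact fun u hu => (hd u hu).differentiableAt.differentiableWithinAt
  · intro u hu
    obtain ⟨h1, h2, _⟩ := hV.2.2.2 u hu
    have h3 := F.g_pos h2 h1
    have h4 := F.f_pos u ⟨hV.1.1.trans_lt hu.1, hu.2⟩
    rw [(hd u hu).deriv]
    have := div_pos h4 h3
    linarith

theorem bddAbove (hc : ContinuousOn F.aplus (Icc (0:ℝ) 1)) (hσ : 0 ≤ σ)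
    (hV : IsRightSolution F σ α V) (hα : 0 < α) :
    BddAbove ((fun u => V u - σ * u) '' Ioo α 1) := by
  by_contra hb
  have hα1 := hV.mem_Ioo hα
  have hanti := hV.antitoneOn
  obtain ⟨m, hm0, hm1, hmD⟩ : ∃ m : ℝ, 0 < m ∧ m ≤ 1 ∧ (α, m) ∈ DSet F.aplus := by
    have h1 : ∀ᶠ m : ℝ in 𝓝[>] 0, (α, m) ∈ DSet F.aplus :=
      (Continuous.continuousAt (f := fun m : ℝ => (α, m)) (by fun_prop)).eventually
        (F.mem_nhds_DSet hc hα1 (F.zero_mem_DSet (Ioo_subset_Icc_self hα1))) |>.filter_mono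
          nhdsWithin_le_nhds
    obtain ⟨m, h2, h3⟩ := (h1.and (Ioc_mem_nhdsGT one_pos)).exists
    exact ⟨m, h3.1, h3.2, h2⟩
  obtain ⟨u₀, hu₀, hu₀V⟩ : ∃ u₀ ∈ Ioo α 1, 1 < V u₀ - σ * u₀ := by
    by_contra! hn
    exact hb ⟨1, by rintro _ ⟨u, hu, rfl⟩; exact hn u hu⟩
  have hline : ContinuousAt (fun u : ℝ => (u, m)) α := by fun_prop
  have hg : ContinuousAt (fun u => F.f u / F.g u m) α :=
    (F.f_contDiffAt hα1).continuousAt.div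
      (ContinuousAt.comp (f := fun u : ℝ => (u, m)) (F.g_contDiffAt hc hα1 hmD).continuousAt hline)
      (F.g_pos hmD hm0).ne'
  set C := F.f α / F.g α m + 1
  have hev : ∀ᶠ u in 𝓝 α, F.f u / F.g u m < C ∧ (u, m) ∈ DSet F.aplus :=
    (hg.eventually (gt_mem_nhds (lt_add_one _))).and
      (hline.eventually (F.mem_nhds_DSet hc hα1 hmD))
  obtain ⟨ε, hε, hball⟩ := Metric.eventually_nhds_iff.1 hev
  set u₁ := min u₀ (α + ε / 2)
  have hu₁ : u₁ ∈ Ioo α 1 := ⟨lt_min hu₀.1 (by linarith), (min_le_left _ _).trans_lt hu₀.2⟩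
  have hder : ∀ u ∈ Ioc α u₁, u ∈ Ioo α 1 ∧ F.f u / F.g u (V u) ≤ C := by
    intro u hu
    have hu' : u ∈ Ioo α 1 := ⟨hu.1, hu.2.trans_lt hu₁.2⟩
    have hd : dist u α < ε := by
      have := hu.2.trans (min_le_right _ _)
      rw [Real.dist_eq, abs_lt]
      constructor <;> linarith [hu.1]
    obtain ⟨h1, h2⟩ := hball hd
    obtain ⟨h3, h4, _⟩ := hV.2.2.2 u hu'
    have h5 : 1 < V u := by
      have h6 := hanti hu' hu₀ (hu.2.trans (min_le_left _ _))
      have h7 : 0 ≤ σ * u := mul_nonneg hσ (hα.trans hu.1).le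
      simp only at h6
      linarith
    refine ⟨hu', le_trans ?_ h1.le⟩
    exact div_le_div_of_nonneg_left (F.f_pos u ⟨hα.trans hu.1, hu'.2⟩).le (F.g_pos h2 hm0)
      (F.g_mono h2 h4 (hm1.trans h5.le))
  have hd : ∀ u ∈ Ioc α u₁, HasDerivAt (fun u => V u - σ * u + C * u)
      (σ - F.f u / F.g u (V u) - σ * 1 + C * 1) u := fun u hu =>
    ((hV.2.2.2 u (hder u hu).1).2.2.sub ((hasDerivAt_id u).const_mul σ)).add
      ((hasDerivAt_id u).const_mul C)
  have hmono : MonotoneOn (fun u => V u - σ * u + C * u) (Ioc α u₁) := by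
    refine monotoneOn_of_deriv_nonneg (convex_Ioc α u₁)
      (fun u hu => (hd u hu).continuousAt.continuousWithinAt)
      (fun u hu => (hd u (interior_subset hu)).differentiableAt.differentiableWithinAt)
      fun u hu => ?_
    rw [(hd u (interior_subset hu)).deriv]
    linarith [(hder u (interior_subset hu)).2]
  have hC : 0 < C := by
    have := div_pos (F.f_pos α hα1) (F.g_pos hmD hm0)
    simp only [C]
    linarith
  refine hb ⟨V u₁ - σ * u₁ + C * u₁, ?_⟩
  rintro _ ⟨u, hu, rfl⟩
  have hCu₁ : 0 ≤ C * u₁ := mul_nonneg hC.le (hα.trans hu₁.1).le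
  rcases le_total u u₁ with h | h
  · have h1 := hmono ⟨hu.1, h⟩ ⟨hu₁.1, le_rfl⟩ h
    have h2 : 0 ≤ C * u := mul_nonneg hC.le (hα.trans hu.1).le
    simp only at h1 ⊢
    linarith
  · have h1 := hanti hu₁ hu h
    simp only at h1 ⊢
    linarith

theorem exists_tendsto (hc : ContinuousOn F.aplus (Icc (0:ℝ) 1)) (hσ : 0 ≤ σ)
    (hV : IsRightSolution F σ α V) (hα : 0 < α) :
    ∃ L : ℝ, Tendsto V (𝓝[>] α) (𝓝 L) := by
  have h1 := AntitoneOn.tendsto_nhdsWithin_Ioo_right (nonempty_Ioo.2 hV.1.2) hV.antitoneOn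
    (hV.bddAbove hc hσ hα)
  have h2 : Tendsto (fun u => σ * u) (𝓝[>] α) (𝓝 (σ * α)) :=
    (by fun_prop : Continuous fun u : ℝ => σ * u).continuousAt.tendsto.mono_left nhdsWithin_le_nhds
  exact ⟨_, by simpa using h1.add h2⟩

theorem eventually_mem_Ioo (hV : IsRightSolution F σ α V) : ∀ᶠ u in 𝓝[>] α, u ∈ Ioo α 1 :=
  Ioo_mem_nhdsGT hV.1.2

theorem tendsto_f (hV : IsRightSolution F σ α V) (hα : 0 < α) :
    Tendsto F.f (𝓝[>] α) (𝓝 (F.f α)) :=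
  (F.f_contDiffAt (hV.mem_Ioo hα)).continuousAt.tendsto.mono_left nhdsWithin_le_nhds

theorem tendsto_g (hc : ContinuousOn F.aplus (Icc (0:ℝ) 1)) (hV : IsRightSolution F σ α V)
    (hα : 0 < α) {L : ℝ} (hL : Tendsto V (𝓝[>] α) (𝓝 L)) (hD : (α, L) ∈ DSet F.aplus) :
    Tendsto (fun u => F.g u (V u)) (𝓝[>] α) (𝓝 (F.g α L)) :=
  (F.g_contDiffAt hc (hV.mem_Ioo hα) hD).continuousAt.tendsto.comp
    ((tendsto_id.mono_left nhdsWithin_le_nhds).prodMk_nhds hL)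

theorem limit_pos (hc : ContinuousOn F.aplus (Icc (0:ℝ) 1)) (hV : IsRightSolution F σ α V)
    (hα : 0 < α) {L : ℝ} (hL : Tendsto V (𝓝[>] α) (𝓝 L)) : 0 < L := by
  have hα1 := hV.mem_Ioo hα
  have hL0 : 0 ≤ L := ge_of_tendsto hL (hV.eventually_mem_Ioo.mono fun u hu => (hV.2.2.2 u hu).1.le)
  refine hL0.lt_of_ne ?_
  rintro rfl
  have hI := Ioo_subset_Icc_self hα1
  have h1 := hV.tendsto_g hc hα hL (F.zero_mem_DSet hI)
  rw [F.g_zero hI] at h1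
  have h2 : Tendsto (fun u => F.g u (V u)) (𝓝[>] α) (𝓝[>] 0) :=
    tendsto_nhdsWithin_iff.2 ⟨h1, hV.eventually_mem_Ioo.mono fun u hu =>
      F.g_pos (hV.2.2.2 u hu).2.1 (hV.2.2.2 u hu).1⟩
  have h3 : Tendsto (fun u => F.f u / F.g u (V u)) (𝓝[>] α) atTop := by
    simpa only [div_eq_mul_inv, Pi.inv_apply] using
      (hV.tendsto_f hα).pos_mul_atTop (F.f_pos α hα1) h2.inv_tendsto_nhdsGT_zero
  obtain ⟨b, hb, hb'⟩ := mem_nhdsGT_iff_exists_Ioo_subset.1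
    ((h3.eventually_gt_atTop σ).and hV.eventually_mem_Ioo)
  have hanti : StrictAntiOn V (Ioo α b) := by
    refine strictAntiOn_of_deriv_neg (convex_Ioo α b)
      (fun u hu => (hV.2.2.2 u (hb' hu).2).2.2.continuousAt.continuousWithinAt) fun u hu => ?_
    rw [interior_Ioo] at hu
    rw [(hV.2.2.2 u (hb' hu).2).2.2.deriv]
    linarith [(hb' hu).1]
  obtain ⟨u, hu⟩ := exists_between (show α < b from hb)
  have h4 : V u ≤ 0 := by
    refine ge_of_tendsto hL ?_
    filter_upwards [Ioo_mem_nhdsGT hu.1] with w hw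
    exact (hanti ⟨hw.1, hw.2.trans hu.2⟩ hu hw.2).le
  exact h4.not_gt (hV.2.2.2 u (hb' hu).2).1

theorem ofReal_limit_le (hc : ContinuousOn F.aplus (Icc (0:ℝ) 1)) (hV : IsRightSolution F σ α V)
    (hα : 0 < α) {L : ℝ} (hL : Tendsto V (𝓝[>] α) (𝓝 L)) : ENNReal.ofReal L ≤ F.aplus α := by
  have hα1 := hV.mem_Ioo hα
  have h1 : Tendsto F.aplus (𝓝[>] α) (𝓝 (F.aplus α)) :=
    (hc.continuousAt (Icc_mem_nhds hα1.1 hα1.2)).tendsto.mono_left nhdsWithin_le_nhds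
  refine le_of_tendsto_of_tendsto (ENNReal.tendsto_ofReal hL) h1 ?_
  filter_upwards [hV.eventually_mem_Ioo] with u hu
  obtain ⟨h2, h3, _⟩ := hV.2.2.2 u hu
  simpa only [abs_of_pos h2] using h3.2.le

theorem exists_extension (hc : ContinuousOn F.aplus (Icc (0:ℝ) 1)) (hV : IsRightSolution F σ α V)
    (hα : 0 < α) {L : ℝ} (hL : Tendsto V (𝓝[>] α) (𝓝 L)) (hL0 : 0 < L)
    (hD : (α, L) ∈ DSet F.aplus) : ∃ β < α, ∃ W, IsRightSolution F σ β W := by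
  have hα1 := hV.mem_Ioo hα
  obtain ⟨c, hcα, hcd⟩ := F.exists_local_solution hc σ hα1 hD hL0
  have hcc : ContinuousAt c α := hcd.self_of_nhds.continuousAt
  have hpair : Tendsto (fun t => (t, c t)) (𝓝 α) (𝓝 (α, L)) := by
    simpa only [hcα, id] using tendsto_id.prodMk_nhds hcc.tendsto
  have hev : ∀ᶠ t in 𝓝 α, 0 < t ∧ 0 < c t ∧ (t, c t) ∈ DSet F.aplus ∧
      HasDerivAt c (σ - F.f t / F.g t (c t)) t :=
    (lt_mem_nhds hα).and ((hcc.eventually (lt_mem_nhds (hcα ▸ hL0))).and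
      ((hpair.eventually (F.mem_nhds_DSet hc hα1 hD)).and hcd))
  obtain ⟨b, hb, hbs⟩ := mem_nhdsLE_iff_exists_Ioc_subset.1
    (hev.filter_mono (nhdsWithin_le_nhds (s := Iic α)))
  obtain ⟨β, hβ1, hβ2⟩ := exists_between (show b < α from hb)
  have hβ0 : 0 < β := (hbs ⟨hβ1, hβ2.le⟩).1
  set W : ℝ → ℝ := fun u => if u ≤ α then c u else V u
  have hWc : EqOn W c (Iic α) := fun u hu => if_pos hu
  have hWV : EqOn W V (Ioi α) := fun u hu => if_neg (not_le.2 hu)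
  have hWder : ∀ u ∈ Ioo β 1, 0 < W u ∧ (u, W u) ∈ DSet F.aplus ∧
      HasDerivAt W (σ - F.f u / F.g u (W u)) u := by
    intro u hu
    rcases lt_trichotomy u α with h | rfl | h
    · obtain ⟨_, h1, h2, h3⟩ := hbs ⟨hβ1.trans hu.1, h.le⟩
      rw [hWc h.le]
      exact ⟨h1, h2, h3.congr_of_eventuallyEq (hWc.eventuallyEq_of_mem (Iic_mem_nhds h))⟩
    · obtain ⟨_, h1, h2, h3⟩ := hbs ⟨hb, le_rfl⟩
      have hWu : W u = L := (hWc self_mem_Iic).trans hcα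
      rw [hWc self_mem_Iic]
      refine ⟨h1, h2, ?_⟩
      rw [hcα] at h3 ⊢
      have hleft : HasDerivWithinAt W (σ - F.f u / F.g u L) (Iic u) u :=
        h3.hasDerivWithinAt.congr hWc (hWc self_mem_Iic)
      have hWd : ∀ w ∈ Ioo u 1, HasDerivAt W (σ - F.f w / F.g w (V w)) w := fun w hw =>
        (hV.2.2.2 w hw).2.2.congr_of_eventuallyEq (hWV.eventuallyEq_of_mem (Ioi_mem_nhds hw.1))
      have hright : HasDerivWithinAt W (σ - F.f u / F.g u L) (Ici u) u := by
        refine hasDerivWithinAt_Ici_of_tendsto_deriv (s := Ioo u 1)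
          (fun w hw => (hWd w hw).differentiableAt.differentiableWithinAt) ?_
          (Ioo_mem_nhdsGT hu.2) ?_
        · rw [ContinuousWithinAt, hWu, nhdsWithin_Ioo_eq_nhdsGT hu.2]
          exact hL.congr' (hWV.symm.eventuallyEq_of_mem self_mem_nhdsWithin)
        · refine Tendsto.congr' (hV.eventually_mem_Ioo.mono fun w hw => (hWd w hw).deriv.symm) ?_
          exact tendsto_const_nhds.sub ((hV.tendsto_f hα).div (hV.tendsto_g hc hα hL hD)
            (F.g_pos hD hL0).ne')
      simpa [Iic_union_Ici] using hleft.union hright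
    · obtain ⟨h1, h2, h3⟩ := hV.2.2.2 u ⟨h, hu.2⟩
      rw [hWV h]
      exact ⟨h1, h2, h3.congr_of_eventuallyEq (hWV.eventuallyEq_of_mem (Ioi_mem_nhds h))⟩
  refine ⟨β, hβ2, W, ⟨hβ0.le, hβ2.trans hα1.2⟩, fun u hu => ?_, (hWV hα1.2).trans hV.2.2.1, hWder⟩
  rcases hu.2.lt_or_eq with h | rfl
  · exact (hWder u ⟨hu.1, h⟩).2.2.continuousAt.continuousWithinAt
  · have h1 : ContinuousWithinAt W (Ioc α 1) 1 :=
      (hV.2.1 1 ⟨hα1.2, le_rfl⟩).congr (fun w hw => hWV hw.1) (hWV hα1.2)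
    refine h1.mono_of_mem_nhdsWithin ?_
    filter_upwards [self_mem_nhdsWithin, nhdsWithin_le_nhds (Ioi_mem_nhds hα1.2)] with w h2 h3
      using ⟨h3, h2.2⟩

end IsRightSolution

theorem stmt5 (F : FluxData) (hc : ContinuousOn F.aplus (Set.Icc (0:ℝ) 1))
    (σ : ℝ) (hσ : 0 ≤ σ) (ασ : ℝ) (V : ℝ → ℝ)
    (hασ : ασ = sInf {α : ℝ | ∃ W : ℝ → ℝ, IsRightSolution F σ α W})
    (hV : IsRightSolution F σ ασ V) (hpos : 0 < ασ) :
    ∃ L : ℝ, 0 < L ∧ F.aplus ασ = ENNReal.ofReal L ∧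
      Filter.Tendsto V (nhdsWithin ασ (Set.Ioi ασ)) (nhds L) := by
  have hbdd : BddBelow {α : ℝ | ∃ W : ℝ → ℝ, IsRightSolution F σ α W} :=
    ⟨0, fun α ⟨_, hW⟩ => hW.1.1⟩
  obtain ⟨L, hL⟩ := hV.exists_tendsto hc hσ hpos
  have hL0 := hV.limit_pos hc hpos hL
  refine ⟨L, hL0, ?_, hL⟩
  refine le_antisymm (not_lt.1 fun hlt => ?_) (hV.ofReal_limit_le hc hpos hL)
  have hD : (ασ, L) ∈ DSet F.aplus :=
    ⟨Ioo_subset_Icc_self (hV.mem_Ioo hpos), by simpa only [abs_of_pos hL0] using hlt⟩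
  obtain ⟨β, hβ, W, hW⟩ := hV.exists_extension hc hpos hL hL0 hD
  have := csInf_le hbdd ⟨W, hW⟩
  rw [← hασ] at this
  exact this.not_gt hβ
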